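/- arXiv:2306.00878 — 2 statements merged into one kernel-verified Lean document; each statement's English description precedes it below -/
import Mathlib

section
/- For every strongly regular graph Γ with parameters (n,k,μ,ν), the four matrices {A₀⊗A₀, (J - A₀)⊗A₀, J⊗A₁, J⊗A₂} span a fusion of the tensor square; that is, their ℝ-linear span is closed under matrix multiplication. (This is the guaranteed wreath-product fusion (𝒯⊗1)≀(1⊗𝒜), partition 23|456|789, of Theorem 3.1(1).) -/
open Matrix Kronecker

/-- The span of a set is closed under multiplication once it contains all products of generators. -/
theorem Submodule.mul_mem_span_of_forall_mul_mem {R A : Type*} [CommSemiring R] [Semiring A]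
    [Algebra R A] {s : Set A} (hs : ∀ x ∈ s, ∀ y ∈ s, x * y ∈ Submodule.span R s)
    {x y : A} (hx : x ∈ Submodule.span R s) (hy : y ∈ Submodule.span R s) :
    x * y ∈ Submodule.span R s := by
  have hle : Submodule.span R s * Submodule.span R s ≤ Submodule.span R s := by
    rw [Submodule.span_mul_span, Submodule.span_le]
    rintro _ ⟨a, ha, b, hb, rfl⟩
    exact hs a ha b hb
  exact hle (Submodule.mul_mem_mul hx hy)

theorem Matrix.of_one_mul_of_one {V R : Type*} [Fintype V] [Semiring R] :
    (Matrix.of fun _ _ => 1 : Matrix V V R) * (Matrix.of fun _ _ => 1 : Matrix V V R) =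
      (Fintype.card V : R) • (Matrix.of fun _ _ => 1 : Matrix V V R) := by
  ext i j
  simp [Matrix.mul_apply]

section Kronecker

variable {l m n p R : Type*} [NonUnitalNonAssocRing R]

theorem Matrix.sub_kronecker (A B : Matrix l m R) (C : Matrix n p R) :
    (A - B) ⊗ₖ C = A ⊗ₖ C - B ⊗ₖ C := by
  ext
  simp [sub_mul]

theorem Matrix.kronecker_sub (A : Matrix l m R) (B C : Matrix n p R) :
    A ⊗ₖ (B - C) = A ⊗ₖ B - A ⊗ₖ C := by
  ext
  simp [mul_sub]

end Kronecker

namespace SimpleGraph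

variable {V R : Type*} [Fintype V] [CommRing R] {G : SimpleGraph V} [DecidableRel G.Adj]

theorem IsRegularOfDegree.adjMatrix_mul_of_one {k : ℕ} (h : G.IsRegularOfDegree k) :
    G.adjMatrix R * (Matrix.of fun _ _ => 1 : Matrix V V R) =
      (k : R) • (Matrix.of fun _ _ => 1 : Matrix V V R) := by
  ext i j
  simp [h.degree_eq i]

theorem IsRegularOfDegree.of_one_mul_adjMatrix {k : ℕ} (h : G.IsRegularOfDegree k) :
    (Matrix.of fun _ _ => 1 : Matrix V V R) * G.adjMatrix R =
      (k : R) • (Matrix.of fun _ _ => 1 : Matrix V V R) := by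
  ext i j
  simp [h.degree_eq j]

theorem IsSRGWith.adjMatrix_mul_self [DecidableEq V] {n k l m : ℕ} (h : G.IsSRGWith n k l m) :
    G.adjMatrix R * G.adjMatrix R =
      (k - m : R) • (1 : Matrix V V R) + (l - m : R) • G.adjMatrix R +
        (m : R) • (Matrix.of fun _ _ => 1 : Matrix V V R) := by
  have hsq := h.matrix_eq (α := R)
  have hc : Gᶜ.adjMatrix R =
      (Matrix.of fun _ _ => 1 : Matrix V V R) - 1 - G.adjMatrix R := by
    ext v w
    obtain rfl | hvw := eq_or_ne v w
    · simp
    · by_cases hadj : G.Adj v w <;> simp [hvw, hadj]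
  rw [← sq, hsq, hc]
  simp only [← Nat.cast_smul_eq_nsmul R]
  module

end SimpleGraph

theorem wreath_trivial_fusion {n k μ ν : ℕ} (Γ : SimpleGraph (Fin n)) [DecidableRel Γ.Adj]
    (h : Γ.IsSRGWith n k μ ν) :
    let A₀ : Matrix (Fin n) (Fin n) ℝ := 1
    let A₁ : Matrix (Fin n) (Fin n) ℝ := Γ.adjMatrix ℝ
    let J : Matrix (Fin n) (Fin n) ℝ := Matrix.of fun _ _ => 1
    let A₂ : Matrix (Fin n) (Fin n) ℝ := J - 1 - A₁
    let S : Set (Matrix (Fin n × Fin n) (Fin n × Fin n) ℝ) :=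
      {A₀ ⊗ₖ A₀, (J - A₀) ⊗ₖ A₀, J ⊗ₖ A₁, J ⊗ₖ A₂}
    ∀ X ∈ Submodule.span ℝ S, ∀ Y ∈ Submodule.span ℝ S, X * Y ∈ Submodule.span ℝ S := by
  intro A₀ A₁ J A₂ S X hX Y hY
  have hJJ : J * J = (n : ℝ) • J := by
    rw [Matrix.of_one_mul_of_one, Fintype.card_fin]
  have hAJ : A₁ * J = (k : ℝ) • J := h.regular.adjMatrix_mul_of_one
  have hJA : J * A₁ = (k : ℝ) • J := h.regular.of_one_mul_adjMatrix
  have hAA : A₁ * A₁ = (k - ν : ℝ) • (1 : Matrix (Fin n) (Fin n) ℝ) + (μ - ν : ℝ) • A₁ +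
      (ν : ℝ) • J := h.adjMatrix_mul_self
  have h₀ : (1 : Matrix (Fin n × Fin n) (Fin n × Fin n) ℝ) ∈ Submodule.span ℝ S := by
    rw [← Matrix.one_kronecker_one]
    exact Submodule.subset_span (by simp [S, A₀])
  have hA : J ⊗ₖ A₁ ∈ Submodule.span ℝ S := Submodule.subset_span (by simp [S])
  have h₁ : J ⊗ₖ (1 : Matrix (Fin n) (Fin n) ℝ) ∈ Submodule.span ℝ S := by
    have hg : (J - A₀) ⊗ₖ A₀ ∈ Submodule.span ℝ S := Submodule.subset_span (by simp [S])
    have := add_mem hg h₀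
    simpa [A₀, Matrix.sub_kronecker] using this
  have hJ : J ⊗ₖ J ∈ Submodule.span ℝ S := by
    have hg : J ⊗ₖ A₂ ∈ Submodule.span ℝ S := Submodule.subset_span (by simp [S])
    have hsum : J ⊗ₖ J = J ⊗ₖ A₂ + J ⊗ₖ 1 + J ⊗ₖ A₁ := by
      simp only [A₂, Matrix.kronecker_sub]
      abel
    exact hsum ▸ add_mem (add_mem hg h₁) hA
  let T : Set (Matrix (Fin n × Fin n) (Fin n × Fin n) ℝ) := {1, J ⊗ₖ 1, J ⊗ₖ A₁, J ⊗ₖ J}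
  have hT₀ : 1 ∈ Submodule.span ℝ T := Submodule.subset_span (by simp [T])
  have hT₁ : J ⊗ₖ 1 ∈ Submodule.span ℝ T := Submodule.subset_span (by simp [T])
  have hTA : J ⊗ₖ A₁ ∈ Submodule.span ℝ T := Submodule.subset_span (by simp [T])
  have hTJ : J ⊗ₖ J ∈ Submodule.span ℝ T := Submodule.subset_span (by simp [T])
  have hST : Submodule.span ℝ S = Submodule.span ℝ T := by
    apply le_antisymm <;> rw [Submodule.span_le]
    · rintro _ (rfl | rfl | rfl | rfl)
      · simpa [A₀] using hT₀
      · simpa [A₀, Matrix.sub_kronecker] using sub_mem hT₁ hT₀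
      · exact hTA
      · simpa [A₂, Matrix.kronecker_sub] using sub_mem (sub_mem hTJ hT₁) hTA
    · rintro _ (rfl | rfl | rfl | rfl) <;> assumption
  rw [hST] at hX hY ⊢
  refine Submodule.mul_mem_span_of_forall_mul_mem ?_ hX hY
  rintro _ (rfl | rfl | rfl | rfl) _ (rfl | rfl | rfl | rfl) <;>
    simp only [one_mul, mul_one, ← Matrix.mul_kronecker_mul, hJJ, hAJ, hJA, hAA,
      Matrix.smul_kronecker, Matrix.kronecker_smul, Matrix.kronecker_add] <;>
    repeat' first | assumption | apply Submodule.add_mem | apply Submodule.smul_mem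
end

section
/- Let Γ be a conference graph: strongly regular with parameters (4ν+1, 2ν, ν-1, ν) for some ν ≥ 1. Then the three matrices {A₀⊗A₀, (J - A₀)⊗A₀ + A₁⊗A₁ + A₂⊗A₂, A₀⊗(J - A₀) + A₂⊗A₁ + A₁⊗A₂} span a fusion of the tensor square; that is, their ℝ-linear span is closed under matrix multiplication. (This is the rank-3 special case fusion with partition 2359|4678 of Theorem 4.3.) -/
open Matrix Kronecker

namespace Matrix

variable {m : Type*} [Fintype m] [DecidableEq m]

theorem conference_kronecker_sq {ν : ℝ} {A B : Matrix m m ℝ}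
    (hAA : A * A = (2 * ν) • 1 + (ν - 1) • A + ν • B)
    (hAB : A * B = ν • A + ν • B) (hBA : B * A = ν • A + ν • B)
    (hBB : B * B = (2 * ν) • 1 + ν • A + (ν - 1) • B) :
    ((A + B) ⊗ₖ (1 : Matrix m m ℝ) + A ⊗ₖ A + B ⊗ₖ B) *
        ((A + B) ⊗ₖ (1 : Matrix m m ℝ) + A ⊗ₖ A + B ⊗ₖ B) =
      (8 * ν ^ 2 + 4 * ν) • ((1 : Matrix m m ℝ) ⊗ₖ (1 : Matrix m m ℝ)) +
      (4 * ν ^ 2 + 2 * ν - 1) • ((A + B) ⊗ₖ (1 : Matrix m m ℝ) + A ⊗ₖ A + B ⊗ₖ B) +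
      (4 * ν ^ 2 + 2 * ν) • ((1 : Matrix m m ℝ) ⊗ₖ (A + B) + B ⊗ₖ A + A ⊗ₖ B) := by
  simp only [add_kronecker, kronecker_add, add_mul, mul_add, ← mul_kronecker_mul, one_mul, mul_one,
    hAA, hAB, hBA, hBB, smul_kronecker, kronecker_smul]
  module

theorem conference_kronecker_mul {ν : ℝ} {A B : Matrix m m ℝ}
    (hAA : A * A = (2 * ν) • 1 + (ν - 1) • A + ν • B)
    (hAB : A * B = ν • A + ν • B) (hBA : B * A = ν • A + ν • B)
    (hBB : B * B = (2 * ν) • 1 + ν • A + (ν - 1) • B) :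
    ((A + B) ⊗ₖ (1 : Matrix m m ℝ) + A ⊗ₖ A + B ⊗ₖ B) *
        ((1 : Matrix m m ℝ) ⊗ₖ (A + B) + B ⊗ₖ A + A ⊗ₖ B) =
      (4 * ν ^ 2 + 2 * ν) • ((A + B) ⊗ₖ (1 : Matrix m m ℝ) + A ⊗ₖ A + B ⊗ₖ B) +
      (4 * ν ^ 2 + 2 * ν) • ((1 : Matrix m m ℝ) ⊗ₖ (A + B) + B ⊗ₖ A + A ⊗ₖ B) := by
  simp only [add_kronecker, kronecker_add, add_mul, mul_add, ← mul_kronecker_mul, one_mul, mul_one,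
    hAA, hAB, hBA, hBB, smul_kronecker, kronecker_smul]
  module

theorem conference_kronecker_mul' {ν : ℝ} {A B : Matrix m m ℝ}
    (hAA : A * A = (2 * ν) • 1 + (ν - 1) • A + ν • B)
    (hAB : A * B = ν • A + ν • B) (hBA : B * A = ν • A + ν • B)
    (hBB : B * B = (2 * ν) • 1 + ν • A + (ν - 1) • B) :
    ((1 : Matrix m m ℝ) ⊗ₖ (A + B) + B ⊗ₖ A + A ⊗ₖ B) *
        ((A + B) ⊗ₖ (1 : Matrix m m ℝ) + A ⊗ₖ A + B ⊗ₖ B) =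
      (4 * ν ^ 2 + 2 * ν) • ((A + B) ⊗ₖ (1 : Matrix m m ℝ) + A ⊗ₖ A + B ⊗ₖ B) +
      (4 * ν ^ 2 + 2 * ν) • ((1 : Matrix m m ℝ) ⊗ₖ (A + B) + B ⊗ₖ A + A ⊗ₖ B) := by
  simp only [add_kronecker, kronecker_add, add_mul, mul_add, ← mul_kronecker_mul, one_mul, mul_one,
    hAA, hAB, hBA, hBB, smul_kronecker, kronecker_smul]
  module

theorem conference_kronecker_sq' {ν : ℝ} {A B : Matrix m m ℝ}
    (hAA : A * A = (2 * ν) • 1 + (ν - 1) • A + ν • B)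
    (hAB : A * B = ν • A + ν • B) (hBA : B * A = ν • A + ν • B)
    (hBB : B * B = (2 * ν) • 1 + ν • A + (ν - 1) • B) :
    ((1 : Matrix m m ℝ) ⊗ₖ (A + B) + B ⊗ₖ A + A ⊗ₖ B) *
        ((1 : Matrix m m ℝ) ⊗ₖ (A + B) + B ⊗ₖ A + A ⊗ₖ B) =
      (8 * ν ^ 2 + 4 * ν) • ((1 : Matrix m m ℝ) ⊗ₖ (1 : Matrix m m ℝ)) +
      (4 * ν ^ 2 + 2 * ν) • ((A + B) ⊗ₖ (1 : Matrix m m ℝ) + A ⊗ₖ A + B ⊗ₖ B) +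
      (4 * ν ^ 2 + 2 * ν - 1) • ((1 : Matrix m m ℝ) ⊗ₖ (A + B) + B ⊗ₖ A + A ⊗ₖ B) := by
  simp only [add_kronecker, kronecker_add, add_mul, mul_add, ← mul_kronecker_mul, one_mul, mul_one,
    hAA, hAB, hBA, hBB, smul_kronecker, kronecker_smul]
  module

end Matrix

theorem Submodule.mul_mem_span_of_forall_mem {R A : Type*} [CommSemiring R] [Semiring A]
    [Algebra R A] {S : Set A} (hS : ∀ x ∈ S, ∀ y ∈ S, x * y ∈ Submodule.span R S)
    {x y : A} (hx : x ∈ Submodule.span R S) (hy : y ∈ Submodule.span R S) :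
    x * y ∈ Submodule.span R S := by
  have hle : Submodule.span R S * Submodule.span R S ≤ Submodule.span R S := by
    rw [Submodule.span_mul_span, Submodule.span_le]
    rintro _ ⟨a, ha, b, hb, rfl⟩
    exact hS a ha b hb
  exact hle (Submodule.mul_mem_mul hx hy)

theorem conference_rank3_fusion {ν : ℕ} (hν : 1 ≤ ν)
    (Γ : SimpleGraph (Fin (4 * ν + 1))) [DecidableRel Γ.Adj]
    (h : Γ.IsSRGWith (4 * ν + 1) (2 * ν) (ν - 1) ν) :
    let A₀ : Matrix (Fin (4 * ν + 1)) (Fin (4 * ν + 1)) ℝ := 1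
    let A₁ : Matrix (Fin (4 * ν + 1)) (Fin (4 * ν + 1)) ℝ := Γ.adjMatrix ℝ
    let J : Matrix (Fin (4 * ν + 1)) (Fin (4 * ν + 1)) ℝ := Matrix.of fun _ _ => 1
    let A₂ : Matrix (Fin (4 * ν + 1)) (Fin (4 * ν + 1)) ℝ := J - 1 - A₁
    let S : Set (Matrix (Fin (4 * ν + 1) × Fin (4 * ν + 1)) (Fin (4 * ν + 1) × Fin (4 * ν + 1)) ℝ) :=
      {A₀ ⊗ₖ A₀, (J - A₀) ⊗ₖ A₀ + A₁ ⊗ₖ A₁ + A₂ ⊗ₖ A₂,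
        A₀ ⊗ₖ (J - A₀) + A₂ ⊗ₖ A₁ + A₁ ⊗ₖ A₂}
    ∀ X ∈ Submodule.span ℝ S, ∀ Y ∈ Submodule.span ℝ S, X * Y ∈ Submodule.span ℝ S := by
  intro A₀ A₁ J A₂ S X hX Y hY
  have hcompl : Γᶜ.adjMatrix ℝ = A₂ := by
    ext i j
    by_cases hij : i = j <;> by_cases ha : Γ.Adj i j <;>
      simp_all [A₂, A₁, J, SimpleGraph.adjMatrix_apply]
  have hAA : A₁ * A₁ = (2 * (ν : ℝ)) • 1 + ((ν : ℝ) - 1) • A₁ + (ν : ℝ) • A₂ := by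
    have hsq := h.matrix_eq (α := ℝ)
    rw [hcompl, pow_two] at hsq
    rw [hsq, ← Nat.cast_smul_eq_nsmul ℝ, ← Nat.cast_smul_eq_nsmul ℝ, ← Nat.cast_smul_eq_nsmul ℝ]
    push_cast [hν]
    rfl
  have hreg : ∀ i, Γ.degree i = 2 * ν := h.regular
  have hAJ : A₁ * J = (2 * (ν : ℝ)) • J := by
    ext i j
    simp [A₁, J, hreg]
  have hJA : J * A₁ = (2 * (ν : ℝ)) • J := by
    ext i j
    simp [A₁, J, hreg]
  have hJJ : J * J = (4 * (ν : ℝ) + 1) • J := by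
    ext i j
    simp [J, Matrix.mul_apply]
  have hJ : J = 1 + A₁ + A₂ := by simp only [A₂]; abel
  have hA₂ : A₂ = J - 1 - A₁ := rfl
  have hAB : A₁ * A₂ = (ν : ℝ) • A₁ + (ν : ℝ) • A₂ := by
    conv_lhs => rw [hA₂]
    rw [mul_sub, mul_sub, hAJ, mul_one, hAA, hJ]
    module
  have hBA : A₂ * A₁ = (ν : ℝ) • A₁ + (ν : ℝ) • A₂ := by
    conv_lhs => rw [hA₂]
    rw [sub_mul, sub_mul, hJA, one_mul, hAA, hJ]
    module
  have hBB : A₂ * A₂ = (2 * (ν : ℝ)) • 1 + (ν : ℝ) • A₁ + ((ν : ℝ) - 1) • A₂ := by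
    have hJB : J * A₂ = (2 * (ν : ℝ)) • J := by
      rw [hA₂, mul_sub, mul_sub, hJJ, hJA, mul_one]
      module
    conv_lhs => enter [1]; rw [hA₂]
    rw [sub_mul, sub_mul, hJB, one_mul, hAB, hJ]
    module
  have hK : J - A₀ = A₁ + A₂ := by simp only [A₂, A₀]; abel
  have hone : A₀ ⊗ₖ A₀ = 1 := Matrix.one_kronecker_one
  refine Submodule.mul_mem_span_of_forall_mem (fun x hx y hy => ?_) hX hY
  have hxS := Submodule.subset_span (R := ℝ) hx
  have hyS := Submodule.subset_span (R := ℝ) hy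
  have h₀ : A₀ ⊗ₖ A₀ ∈ Submodule.span ℝ S := Submodule.subset_span (by simp [S])
  have h₁ : (A₁ + A₂) ⊗ₖ A₀ + A₁ ⊗ₖ A₁ + A₂ ⊗ₖ A₂ ∈ Submodule.span ℝ S :=
    Submodule.subset_span (by simp [S, hK])
  have h₂ : A₀ ⊗ₖ (A₁ + A₂) + A₂ ⊗ₖ A₁ + A₁ ⊗ₖ A₂ ∈ Submodule.span ℝ S :=
    Submodule.subset_span (by simp [S, hK])
  simp only [S, Set.mem_insert_iff, Set.mem_singleton_iff, hK] at hx hy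
  rcases hx with rfl | hx
  · rwa [hone, one_mul]
  rcases hy with rfl | hy
  · rwa [hone, mul_one]
  rcases hx with rfl | rfl <;> rcases hy with rfl | rfl
  · rw [Matrix.conference_kronecker_sq hAA hAB hBA hBB]
    exact add_mem (add_mem (Submodule.smul_mem _ _ h₀) (Submodule.smul_mem _ _ h₁))
      (Submodule.smul_mem _ _ h₂)
  · rw [Matrix.conference_kronecker_mul hAA hAB hBA hBB]
    exact add_mem (Submodule.smul_mem _ _ h₁) (Submodule.smul_mem _ _ h₂)
  · rw [Matrix.conference_kronecker_mul' hAA hAB hBA hBB]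
    exact add_mem (Submodule.smul_mem _ _ h₁) (Submodule.smul_mem _ _ h₂)
  · rw [Matrix.conference_kronecker_sq' hAA hAB hBA hBB]
    exact add_mem (add_mem (Submodule.smul_mem _ _ h₀) (Submodule.smul_mem _ _ h₁))
      (Submodule.smul_mem _ _ h₂)
end
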